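/- Let G be a 2-connected closed claw-free non-Hamiltonian graph on n vertices. If the clique number satisfies ω(G) ≥ n − 6, then G is isomorphic to a graph in the family ℰ𝒫_n. -/

import Mathlib

open SimpleGraph

/-- A graph is claw-free if it contains no induced `K_{1,3}`. -/
def ClawFree {V : Type*} (G : SimpleGraph V) : Prop :=
  ¬ ∃ v a b c : V, a ≠ b ∧ a ≠ c ∧ b ≠ c ∧
    G.Adj v a ∧ G.Adj v b ∧ G.Adj v c ∧ ¬ G.Adj a b ∧ ¬ G.Adj a c ∧ ¬ G.Adj b c

/-- A graph is traceable if it has a Hamilton path. -/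
def Traceable {V : Type*} (G : SimpleGraph V) : Prop := by
  classical
  exact ∃ (u v : V) (p : G.Walk u v), p.IsHamiltonian

/-- A graph is 2-connected if it has at least 3 vertices and deleting any
single vertex leaves a connected graph. -/
def TwoConnected {V : Type*} [Fintype V] [DecidableEq V] (G : SimpleGraph V) : Prop :=
  3 ≤ Fintype.card V ∧ ∀ v : V, (G.induce ({v}ᶜ : Set V)).Connected

/-- A vertex is eligible if its neighbourhood induces a connected non-complete graph. -/
def Eligible {V : Type*} (G : SimpleGraph V) (x : V) : Prop :=
  (G.induce (G.neighborSet x)).Connected ∧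
    ∃ u v : V, G.Adj x u ∧ G.Adj x v ∧ u ≠ v ∧ ¬ G.Adj u v

/-- A claw-free graph is closed if it has no eligible vertex. -/
def IsClosedGraph {V : Type*} (G : SimpleGraph V) : Prop := ∀ x : V, ¬ Eligible G x

/-- The spectral radius of a graph: the largest eigenvalue of its adjacency matrix. -/
noncomputable def adjSpectralRadius {V : Type*} [Fintype V] [DecidableEq V] (G : SimpleGraph V) : ℝ := by
  classical
  exact sSup {μ : ℝ | ∃ x : V → ℝ, x ≠ 0 ∧ (G.adjMatrix ℝ).mulVec x = μ • x}

/-- The `Q`-index of a graph: the largest eigenvalue of `Q = D + A`. -/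
noncomputable def qIndex {V : Type*} [Fintype V] [DecidableEq V] (G : SimpleGraph V) : ℝ := by
  classical
  exact sSup {μ : ℝ | ∃ x : V → ℝ, x ≠ 0 ∧
    (Matrix.diagonal (fun v => (G.degree v : ℝ)) + G.adjMatrix ℝ).mulVec x = μ • x}

/-- `EN n`: the complete graph on `{0, …, n-4}` together with pendant vertices
`n-3, n-2, n-1` attached to `0, 1, 2` respectively. -/
def ENgraph (n : ℕ) : SimpleGraph (Fin n) :=
  SimpleGraph.fromRel (fun i j =>
    (i.val < n - 3 ∧ j.val < n - 3) ∨ j.val = i.val + (n - 3))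

/-- `EP n`: a clique on `{0,…,n-7}` with `a_i = i`, a triangle `b_i = n-6+i`,
and vertices `c_i = n-3+i` with edges `a_i b_i`, `a_i c_i`, `b_i c_i` (`i = 0,1,2`). -/
def EPgraph (n : ℕ) : SimpleGraph (Fin n) :=
  SimpleGraph.fromRel (fun i j =>
    (i.val < n - 6 ∧ j.val < n - 6) ∨
    (n - 6 ≤ i.val ∧ i.val < n - 3 ∧ n - 6 ≤ j.val ∧ j.val < n - 3) ∨
    (i.val < 3 ∧ (j.val = i.val + (n - 6) ∨ j.val = i.val + (n - 3))) ∨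
    (n - 6 ≤ i.val ∧ i.val < n - 3 ∧ j.val = i.val + 3))

/-- `EP' n`: a clique on `{0,…,n-7}` with `a₁ = 0`, `b₁ = 1`, `c₁ = 2`, triangles
`a₁a₂a₃` and `b₁b₂b₃` where `a₂ = n-6`, `a₃ = n-5`, `b₂ = n-4`, `b₃ = n-3`, and
vertices `c₂ = n-2`, `c₃ = n-1` with edges `a_i b_i`, `a_i c_i`, `b_i c_i` for `i = 2,3`. -/
def EP'graph (n : ℕ) : SimpleGraph (Fin n) :=
  SimpleGraph.fromRel (fun i j =>
    (i.val < n - 6 ∧ j.val < n - 6) ∨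
    (i.val = 0 ∧ (j.val = n - 6 ∨ j.val = n - 5)) ∨
    (i.val = 1 ∧ (j.val = n - 4 ∨ j.val = n - 3)) ∨
    (i.val = n - 6 ∧ (j.val = n - 5 ∨ j.val = n - 4 ∨ j.val = n - 2)) ∨
    (i.val = n - 5 ∧ (j.val = n - 3 ∨ j.val = n - 1)) ∨
    (i.val = n - 4 ∧ (j.val = n - 3 ∨ j.val = n - 2)) ∨
    (i.val = n - 3 ∧ j.val = n - 1))

/-- The graph `P_{x₁,x₂,x₃}` on 9 vertices: triangles `a₁a₂a₃ = {0,1,2}` and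
`b₁b₂b₃ = {3,4,5}`, vertices `c_i = 6+i` adjacent to `a_i = i` and `b_i = 3+i`,
and additionally the edge `a_i b_i` whenever `t i = true` (the `T` case). -/
def Pgraph (t : Fin 3 → Bool) : SimpleGraph (Fin 9) :=
  SimpleGraph.fromRel (fun i j =>
    (i.val < 3 ∧ j.val < 3) ∨
    (3 ≤ i.val ∧ i.val < 6 ∧ 3 ≤ j.val ∧ j.val < 6) ∨
    (6 ≤ j.val ∧ (j.val = i.val + 6 ∨ j.val = i.val + 3)) ∨
    (∃ k : Fin 3, t k = true ∧ i.val = k.val ∧ j.val = k.val + 3))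

/-- Replace a triangle `T` of `H` by a complete graph: add `m` new vertices
adjacent to one another and to every vertex of `T`. -/
def expandGraph (H : SimpleGraph (Fin 9)) (T : Set (Fin 9)) (m : ℕ) :
    SimpleGraph (Fin 9 ⊕ Fin m) :=
  SimpleGraph.fromRel (fun u v =>
    match u, v with
    | Sum.inl a, Sum.inl b => H.Adj a b
    | Sum.inl a, Sum.inr _ => a ∈ T
    | Sum.inr _, Sum.inl _ => False
    | Sum.inr _, Sum.inr _ => True)

/-- `PathOn G x y S`: there is a path of `G` from `x` to `y` whose vertex set is exactly `S`. -/
inductive PathOn {V : Type*} [DecidableEq V] (G : SimpleGraph V) : V → V → Finset V → Prop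
  | single (x : V) : PathOn G x x {x}
  | cons {x y z : V} {S : Finset V} (hxy : G.Adj x y) (hx : x ∉ S) (p : PathOn G y z S) :
      PathOn G x z (insert x S)

/-- The vertex set `S` carries a cycle of `G`; an edge counts as a cycle on two vertices. -/
def CycleOn {V : Type*} [DecidableEq V] (G : SimpleGraph V) (S : Finset V) : Prop :=
  ∃ x y, PathOn G x y S ∧ G.Adj y x

section Paths

variable {V : Type*} [DecidableEq V] {G : SimpleGraph V}

theorem PathOn.left_mem {x y : V} {S : Finset V} (p : PathOn G x y S) : x ∈ S := by
  cases p <;> simp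

theorem PathOn.right_mem {x y : V} {S : Finset V} (p : PathOn G x y S) : y ∈ S := by
  induction p with
  | single => simp
  | cons _ _ _ ih => exact Finset.mem_insert_of_mem ih

theorem PathOn.append {x y z w : V} {S T : Finset V} (p : PathOn G x y S) (hyz : G.Adj y z)
    (q : PathOn G z w T) (hST : Disjoint S T) : PathOn G x w (S ∪ T) := by
  induction p with
  | single x =>
    rw [← Finset.insert_eq]
    exact .cons hyz (by simpa using hST) q
  | cons h hx _ ih =>
    rw [Finset.disjoint_insert_left] at hST
    rw [Finset.insert_union]
    exact .cons h (by simp [hx, hST.1]) (ih hyz hST.2)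

theorem PathOn.symm {x y : V} {S : Finset V} (p : PathOn G x y S) : PathOn G y x S := by
  induction p with
  | single x => exact .single x
  | cons h hx _ ih =>
    rw [Finset.insert_eq, Finset.union_comm]
    exact ih.append h.symm (.single _) (by simpa using hx)

/-- Splitting a path just before an inner vertex. -/
theorem PathOn.split {x y z : V} {S : Finset V} (p : PathOn G x y S) (hz : z ∈ S) :
    x = z ∨ ∃ w S₁ S₂, PathOn G x w S₁ ∧ G.Adj w z ∧ PathOn G z y S₂ ∧ Disjoint S₁ S₂ ∧
      S = S₁ ∪ S₂ := by
  induction p with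
  | single x => exact .inl (Finset.mem_singleton.1 hz).symm
  | @cons x u y S h hx q ih =>
    rcases Finset.mem_insert.1 hz with rfl | hz
    · exact .inl rfl
    · right
      rcases ih hz with rfl | ⟨w, S₁, S₂, p₁, hw, p₂, hd, rfl⟩
      · exact ⟨x, {x}, S, .single x, h, q, by simpa using hx, Finset.insert_eq _ _⟩
      · rw [Finset.mem_union, not_or] at hx
        exact ⟨w, insert x S₁, S₂, .cons h hx.1 p₁, hw, p₂, by simp [hd, hx.2],
          (Finset.insert_union _ _ _).symm⟩

theorem PathOn.reroot {S Q : Finset V} {p q q' : V} (hpq : G.Adj p q) (hp : p ∉ S)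
    (h : PathOn G q q' Q) (hQ : Disjoint Q S) : ∃ Q', PathOn G p q' Q' ∧ Disjoint Q' S := by
  by_cases hpQ : p ∈ Q
  · rcases h.split hpQ with rfl | ⟨_, S₁, S₂, -, -, h₂, -, rfl⟩
    · exact ⟨Q, h, hQ⟩
    · exact ⟨S₂, h₂, (Finset.disjoint_union_left.1 hQ).2⟩
  · exact ⟨_, .cons hpq hpQ h, Finset.disjoint_insert_left.2 ⟨hp, hQ⟩⟩

theorem PathOn.exists_last {x y : V} {S : Finset V} (p : PathOn G x y S) (hxy : x ≠ y) :
    ∃ w T, PathOn G x w T ∧ G.Adj w y ∧ y ∉ T ∧ S = insert y T := by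
  obtain ⟨_⟩ | ⟨h, hx, q⟩ := p.symm
  · exact absurd rfl hxy
  · exact ⟨_, _, q.symm, h.symm, hx, rfl⟩

theorem pathOn_of_isClique {x y : V} {T : Finset V} (hT : G.IsClique (T : Set V)) (hx : x ∈ T)
    (hy : y ∈ T) (hxy : x ≠ y) : PathOn G x y T := by
  induction hn : T.card generalizing x T with
  | zero => simp_all
  | succ n ih =>
    have hyT : y ∈ T.erase x := by simp [hy, hxy.symm]
    rw [← Finset.insert_erase hx]
    by_cases h : ∃ z ∈ T.erase x, z ≠ y
    · obtain ⟨z, hz, hzy⟩ := h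
      have hz' := Finset.mem_erase.1 hz
      refine .cons (hT hx hz'.2 hz'.1.symm) (by simp)
        (ih (hT.subset (by simp)) hz hyT hzy ?_)
      rw [Finset.card_erase_of_mem hx]; omega
    · have : T.erase x = {y} := by
        push Not at h
        exact Finset.eq_singleton_iff_unique_mem.2 ⟨hyT, h⟩
      rw [this]
      exact .cons (hT hx hy hxy) (by simpa using hxy) (.single y)

theorem pathOn_of_isChain {x : V} {l : List V} (hl : (x :: l).IsChain G.Adj)
    (hn : (x :: l).Nodup) : PathOn G x ((x :: l).getLast (by simp)) (x :: l).toFinset := by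
  induction l generalizing x with
  | nil => simpa using PathOn.single x
  | cons y l ih =>
    rw [List.isChain_cons_cons] at hl
    rw [List.nodup_cons] at hn
    rw [List.toFinset_cons, List.getLast_cons (by simp)]
    exact .cons hl.1 (by simpa using hn.1) (ih hl.2 hn.2)

theorem PathOn.exists_walk {x y : V} {S : Finset V} (p : PathOn G x y S) :
    ∃ w : G.Walk x y, w.IsPath ∧ ∀ v, v ∈ w.support ↔ v ∈ S := by
  induction p with
  | single x => exact ⟨.nil, by simp, by simp⟩
  | cons h hx _ ih =>
    obtain ⟨w, hw, hS⟩ := ih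
    exact ⟨.cons h w, by simp [SimpleGraph.Walk.cons_isPath_iff, hw, hS, hx], by simp [hS]⟩

theorem CycleOn.isHamiltonian [Fintype V] (h : CycleOn G Finset.univ)
    (hV : 3 ≤ Fintype.card V) : G.IsHamiltonian := by
  obtain ⟨x, y, p, hyx⟩ := h
  obtain ⟨w, hw, hS⟩ := p.exists_walk
  have hham : w.IsHamiltonian := hw.isHamiltonian_of_mem (by simpa using hS)
  intro _
  refine ⟨y, .cons hyx w, Walk.isHamiltonianCycle_iff_isCycle_and_support_count_tail_eq_one.2
    ⟨(SimpleGraph.Walk.cons_isCycle_iff _ _).2 ⟨hw, fun he => ?_⟩, hham⟩⟩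
  have hl := hham.length_eq
  cases w with
  | nil => simp at he
  | cons h w' =>
    rw [SimpleGraph.Walk.cons_isPath_iff] at hw
    rw [SimpleGraph.Walk.edges_cons, List.mem_cons] at he
    rcases he with he | he
    · have : w'.length = 0 := by
        have hy := w'.end_mem_support
        rcases Sym2.eq_iff.1 he with ⟨rfl, -⟩ | ⟨rfl, -⟩
        · exact absurd rfl hyx.ne
        · exact SimpleGraph.Walk.length_eq_zero_iff.2 (SimpleGraph.Walk.isPath_iff_nil.1 hw.1)
      simp [this] at hl
      omega
    · exact hw.2 (w'.snd_mem_support_of_mem_edges he)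

/-- A cycle through two vertices consists of two arcs, one of which may be a single edge. -/
theorem CycleOn.split {S : Finset V} (h : CycleOn G S) {c d : V} (hc : c ∈ S) (hd : d ∈ S)
    (hcd : c ≠ d) : PathOn G c d S ∨ ∃ a a' b b' A B, G.Adj c a ∧ PathOn G a a' A ∧ G.Adj a' d ∧
      G.Adj d b ∧ PathOn G b b' B ∧ G.Adj b' c ∧ c ∉ A ∧ c ∉ B ∧ d ∉ A ∧ d ∉ B ∧ Disjoint A B ∧
      S = insert c (insert d (A ∪ B)) := by
  obtain ⟨y, p, hyc⟩ : ∃ y, PathOn G c y S ∧ G.Adj y c := by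
    obtain ⟨x, y, p, hyx⟩ := h
    rcases p.split hc with rfl | ⟨w, S₁, S₂, p₁, hw, p₂, hS, rfl⟩
    · exact ⟨y, p, hyx⟩
    · exact ⟨w, Finset.union_comm S₁ S₂ ▸ p₂.append hyx p₁ hS.symm, hw⟩
  cases p with
  | single => exact absurd rfl hyc.ne
  | @cons _ a _ S hca hcS q =>
    have hdS : d ∈ S := by simpa [hcd.symm] using hd
    rcases q.split hdS with rfl | ⟨a', A, T, p₁, ha', p₂, hAT, rfl⟩
    · left
      rw [Finset.insert_eq, Finset.union_comm]
      exact (q.append hyc (.single c) (by simpa using hcS)).symm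
    · cases p₂ with
      | single =>
        left
        exact .cons hca hcS (p₁.append ha' (.single _) hAT)
      | @cons _ b _ B hb hdB p₃ =>
        right
        simp only [Finset.mem_union, Finset.mem_insert, not_or, Finset.disjoint_insert_right]
          at hcS hAT
        exact ⟨a, a', b, y, A, B, hca, p₁, ha', hb, p₃, hyc, hcS.1, hcS.2.2, hAT.1, hdB, hAT.2,
          by rw [Finset.union_insert]⟩

end Paths

/-- The induced copy of some `P_{x₁,x₂,x₃}` given by `a`, `b`, `m` (its vertices `aᵢ`, `bᵢ`, `cᵢ`)
contains all vertices outside `K`, and the vertices of `K` outside the copy have no neighbour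
in it apart from those in `K`. -/
structure IsFrame {V : Type*} (G : SimpleGraph V) (K : Finset V) (a b m : Fin 3 → V) : Prop where
  a_adj : ∀ i j, i ≠ j → G.Adj (a i) (a j)
  b_adj : ∀ i j, i ≠ j → G.Adj (b i) (b j)
  am_adj : ∀ i, G.Adj (a i) (m i)
  bm_adj : ∀ i, G.Adj (b i) (m i)
  ab_nonadj : ∀ i j, i ≠ j → ¬ G.Adj (a i) (b j)
  am_nonadj : ∀ i j, i ≠ j → ¬ G.Adj (a i) (m j)
  bm_nonadj : ∀ i j, i ≠ j → ¬ G.Adj (b i) (m j)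
  mm_nonadj : ∀ i j, ¬ G.Adj (m i) (m j)
  outside : ∀ v ∉ K, ∃ i, v = a i ∨ v = b i ∨ v = m i
  attach : ∀ k ∈ K, (∀ i, k ≠ a i ∧ k ≠ b i ∧ k ≠ m i) → ∀ v ∉ K, ¬ G.Adj k v

theorem IsFrame.comp {V : Type*} {G : SimpleGraph V} {K : Finset V} {a b m : Fin 3 → V}
    (h : IsFrame G K a b m) (σ : Equiv.Perm (Fin 3)) : IsFrame G K (a ∘ σ) (b ∘ σ) (m ∘ σ) where
  a_adj i j hij := h.a_adj _ _ (σ.injective.ne hij)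
  b_adj i j hij := h.b_adj _ _ (σ.injective.ne hij)
  am_adj i := h.am_adj _
  bm_adj i := h.bm_adj _
  ab_nonadj i j hij := h.ab_nonadj _ _ (σ.injective.ne hij)
  am_nonadj i j hij := h.am_nonadj _ _ (σ.injective.ne hij)
  bm_nonadj i j hij := h.bm_nonadj _ _ (σ.injective.ne hij)
  mm_nonadj i j := h.mm_nonadj _ _
  outside v hv := by
    obtain ⟨i, hi⟩ := h.outside v hv
    exact ⟨σ.symm i, by simpa using hi⟩
  attach k hk hne := h.attach k hk fun i => by simpa using hne (σ.symm i)

/-- The vertices of a frame in the order used by `Pgraph`. -/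
def frameVertex {V : Type*} (a b m : Fin 3 → V) : Fin 9 → V :=
  ![a 0, a 1, a 2, b 0, b 1, b 2, m 0, m 1, m 2]

theorem IsFrame.adj_iff {V : Type*} {G : SimpleGraph V} {K : Finset V} {a b m : Fin 3 → V}
    (h : IsFrame G K a b m) {t : Fin 3 → Bool} (ht : ∀ i, t i = true ↔ G.Adj (a i) (b i))
    (i j : Fin 9) :
    G.Adj (frameVertex a b m i) (frameVertex a b m j) ↔ (Pgraph t).Adj i j := by
  have h1 := h.a_adj
  have h2 := h.b_adj
  have h3 := h.am_adj
  have h4 := h.bm_adj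
  have h5 := h.ab_nonadj
  have h6 := h.am_nonadj
  have h7 := h.bm_nonadj
  have h3' := fun i => (h.am_adj i).symm
  have h4' := fun i => (h.bm_adj i).symm
  have h5' : ∀ i j, i ≠ j → ¬ G.Adj (b i) (a j) := fun i j hij e =>
    h.ab_nonadj j i hij.symm e.symm
  have h6' : ∀ i j, i ≠ j → ¬ G.Adj (m i) (a j) := fun i j hij e =>
    h.am_nonadj j i hij.symm e.symm
  have h7' : ∀ i j, i ≠ j → ¬ G.Adj (m i) (b j) := fun i j hij e =>
    h.bm_nonadj j i hij.symm e.symm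
  have h8 := h.mm_nonadj
  have ht' : ∀ i, G.Adj (b i) (a i) ↔ t i = true := fun i => by rw [ht, G.adj_comm]
  fin_cases i <;> fin_cases j <;>
    simp [frameVertex, Pgraph, Fin.exists_fin_succ, *]

instance (t : Fin 3 → Bool) : DecidableRel (Pgraph t).Adj := fun _ _ =>
  decidable_of_iff _ (SimpleGraph.fromRel_adj _ _ _).symm

/-- Distinct vertices of `Pgraph t` have distinct neighbourhoods. -/
theorem Pgraph_adj_separates : ∀ (t : Fin 3 → Bool) (i j : Fin 9),
    (∀ k, (Pgraph t).Adj i k ↔ (Pgraph t).Adj j k) → i = j := by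
  decide +kernel

theorem IsFrame.injective {V : Type*} {G : SimpleGraph V} {K : Finset V} {a b m : Fin 3 → V}
    (h : IsFrame G K a b m) : Function.Injective (frameVertex a b m) := by
  classical
  intro i j hij
  refine Pgraph_adj_separates (fun i => decide (G.Adj (a i) (b i))) i j fun k => ?_
  rw [← h.adj_iff (by simp), ← h.adj_iff (by simp), hij]

theorem IsFrame.nonempty_iso {V : Type*} [Fintype V] [DecidableEq V] {G : SimpleGraph V}
    {K : Finset V} {a b m : Fin 3 → V} (h : IsFrame G K a b m) (hK : G.IsClique (K : Set V))
    (hc : Kᶜ.card = 6) {t : Fin 3 → Bool} (ht : ∀ i, t i = true ↔ G.Adj (a i) (b i)) :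
    ∃ T : Finset (Fin 9), (Pgraph t).IsNClique 3 T ∧
      Nonempty (G ≃g expandGraph (Pgraph t) (↑T) (Fintype.card V - 9)) := by
  set p := frameVertex a b m with hp
  have hinj : Function.Injective p := h.injective
  have hadj : ∀ i j, G.Adj (p i) (p j) ↔ (Pgraph t).Adj i j := h.adj_iff ht
  have hout : ∀ v ∉ K, ∃ i, p i = v := by
    intro v hv
    obtain ⟨i, hi⟩ := h.outside v hv
    rcases hi with rfl | rfl | rfl <;> fin_cases i
    exacts [⟨0, rfl⟩, ⟨1, rfl⟩, ⟨2, rfl⟩, ⟨3, rfl⟩, ⟨4, rfl⟩, ⟨5, rfl⟩, ⟨6, rfl⟩, ⟨7, rfl⟩, ⟨8, rfl⟩]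
  have hattach : ∀ k ∈ K, (∀ i, p i ≠ k) → ∀ i, p i ∉ K → ¬ G.Adj k (p i) := by
    intro k hk hne i hi
    refine h.attach k hk (fun j => ?_) _ hi
    fin_cases j
    exacts [⟨(hne 0).symm, (hne 3).symm, (hne 6).symm⟩, ⟨(hne 1).symm, (hne 4).symm, (hne 7).symm⟩,
      ⟨(hne 2).symm, (hne 5).symm, (hne 8).symm⟩]
  let T : Finset (Fin 9) := Finset.univ.filter fun i => p i ∈ K
  have hT : ∀ i, i ∈ T ↔ p i ∈ K := by simp [T]
  have hTc : Tᶜ.card = 6 := by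
    rw [← hc, ← Finset.card_map ⟨p, hinj⟩]
    congr 1
    ext v
    simp only [Finset.mem_map, Finset.mem_compl, hT, Function.Embedding.coeFn_mk]
    constructor
    · rintro ⟨i, hi, rfl⟩
      exact hi
    · intro hv
      obtain ⟨i, rfl⟩ := hout v hv
      exact ⟨i, hv, rfl⟩
  refine ⟨T, ⟨fun i hi j hj hij => ?_, ?_⟩, ?_⟩
  · exact (hadj i j).1 (hK ((hT i).1 hi) ((hT j).1 hj) (hinj.ne hij))
  · rw [Finset.card_compl, Fintype.card_fin] at hTc
    omega
  · let E := {v : V // ∀ i, p i ≠ v}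
    have hE : Fintype.card E = Fintype.card V - 9 := by
      have h1 := Fintype.card_congr (Equiv.ofInjective p hinj)
      rw [Fintype.card_fin] at h1
      have h2 := Fintype.card_compl_set (Set.range p)
      rw [← h1] at h2
      rw [← h2]
      refine Fintype.card_congr (Equiv.subtypeEquivRight fun v => ?_)
      simp
    let e : E ≃ Fin (Fintype.card V - 9) := Fintype.equivFinOfCardEq hE
    let f : Fin 9 ⊕ Fin (Fintype.card V - 9) → V := Sum.elim p fun k => (e.symm k : V)
    have hek : ∀ k, (e.symm k : V) ∈ K := fun k => by
      by_contra hk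
      obtain ⟨i, hi⟩ := hout _ hk
      exact (e.symm k).2 i hi
    have hbij : Function.Bijective f := by
      refine ⟨Function.Injective.sumElim hinj (Subtype.val_injective.comp e.symm.injective)
        fun i k => (e.symm k).2 i, fun v => ?_⟩
      by_cases hv : ∃ i, p i = v
      · obtain ⟨i, rfl⟩ := hv
        exact ⟨.inl i, rfl⟩
      · exact ⟨.inr (e ⟨v, by simpa using hv⟩), by simp [f]⟩
    have hmixed : ∀ i k, G.Adj (p i) (e.symm k) ↔ i ∈ T := fun i k => by
      rw [hT]
      refine ⟨fun hik => ?_, fun hi => hK hi (hek k) ((e.symm k).2 i)⟩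
      by_contra hi
      exact hattach _ (hek k) (e.symm k).2 i hi hik.symm
    refine ⟨(RelIso.symm ⟨Equiv.ofBijective f hbij, ?_⟩)⟩
    rintro (i | k) (j | l)
    · simpa [f, expandGraph, hadj, (Pgraph t).adj_comm j i] using fun hij => hij.ne
    · simpa [f, expandGraph] using hmixed i l
    · simpa [f, expandGraph, G.adj_comm] using hmixed j k
    · have : G.Adj (e.symm k : V) (e.symm l) ↔ k ≠ l := by
        refine ⟨fun hkl hk => hkl.ne (by rw [hk]), fun hkl => hK (hek k) (hek l) fun hv => hkl ?_⟩
        exact e.symm.injective (Subtype.ext hv)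
      simpa [f, expandGraph] using this

theorem IsFrame.exists_iso {V : Type*} [Fintype V] [DecidableEq V] {G : SimpleGraph V}
    {K : Finset V} {a b m : Fin 3 → V} (h : IsFrame G K a b m) (hK : G.IsClique (K : Set V))
    (hc : Kᶜ.card = 6) :
    ∃ t ∈ ({(fun _ => true), ![false, true, true], ![false, false, true],
        (fun _ => false)} : Set (Fin 3 → Bool)),
      ∃ T : Finset (Fin 9), (Pgraph t).IsNClique 3 T ∧
        Nonempty (G ≃g expandGraph (Pgraph t) (↑T) (Fintype.card V - 9)) := by
  classical
  have hsort : ∀ s : Fin 3 → Bool, ∃ σ : Equiv.Perm (Fin 3), s ∘ σ = (fun _ => true) ∨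
      s ∘ σ = ![false, true, true] ∨ s ∘ σ = ![false, false, true] ∨ s ∘ σ = fun _ => false := by
    decide
  obtain ⟨σ, hσ⟩ := hsort fun i => decide (G.Adj (a i) (b i))
  exact ⟨_, hσ, (h.comp σ).nonempty_iso hK hc (by simp)⟩

section Ears

variable {V : Type*} [DecidableEq V] {G : SimpleGraph V}

/-- A cycle `c A d B`, covering `K`, and a path `Q` from `c` to `d` whose inner vertices avoid this
cycle, such that no cycle through all vertices of `c A d B` meets `Q`. -/
structure IsEar (G : SimpleGraph V) (K : Finset V) (c d q q' a a' b b' : V) (Q A B : Finset V) :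
    Prop where
  cq : G.Adj c q
  dq : G.Adj d q'
  ca : G.Adj c a
  da : G.Adj d a'
  db : G.Adj d b
  cb : G.Adj c b'
  pathQ : PathOn G q q' Q
  pathA : PathOn G a a' A
  pathB : PathOn G b b' B
  ne : c ≠ d
  c_notMem : c ∉ Q ∧ c ∉ A ∧ c ∉ B
  d_notMem : d ∉ Q ∧ d ∉ A ∧ d ∉ B
  disjoint_QA : Disjoint Q A
  disjoint_QB : Disjoint Q B
  disjoint_AB : Disjoint A B
  subset : ∀ v ∈ K, v = c ∨ v = d ∨ v ∈ A ∨ v ∈ B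
  maximal : ∀ {S x y}, PathOn G x y S → G.Adj y x → (∃ v ∈ Q, v ∈ S) →
    (∀ v, v = c ∨ v = d ∨ v ∈ A ∨ v ∈ B → v ∈ S) → False

namespace IsEar

variable {K : Finset V} {c d q q' a a' b b' : V} {Q A B : Finset V}

theorem swap (h : IsEar G K c d q q' a a' b b' Q A B) : IsEar G K d c q' q b b' a a' Q B A where
  cq := h.dq
  dq := h.cq
  ca := h.db
  da := h.cb
  db := h.ca
  cb := h.da
  pathQ := h.pathQ.symm
  pathA := h.pathB
  pathB := h.pathA
  ne := h.ne.symm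
  c_notMem := ⟨h.d_notMem.1, h.d_notMem.2.2, h.d_notMem.2.1⟩
  d_notMem := ⟨h.c_notMem.1, h.c_notMem.2.2, h.c_notMem.2.1⟩
  disjoint_QA := h.disjoint_QB
  disjoint_QB := h.disjoint_QA
  disjoint_AB := h.disjoint_AB.symm
  subset v hv := by have := h.subset v hv; tauto
  maximal p hyx hQ hS := h.maximal p hyx hQ fun v hv => hS v (by tauto)

theorem rev (h : IsEar G K c d q q' a a' b b' Q A B) : IsEar G K c d q q' b' b a' a Q B A where
  cq := h.cq
  dq := h.dq
  ca := h.cb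
  da := h.db
  db := h.da
  cb := h.ca
  pathQ := h.pathQ
  pathA := h.pathB.symm
  pathB := h.pathA.symm
  ne := h.ne
  c_notMem := ⟨h.c_notMem.1, h.c_notMem.2.2, h.c_notMem.2.1⟩
  d_notMem := ⟨h.d_notMem.1, h.d_notMem.2.2, h.d_notMem.2.1⟩
  disjoint_QA := h.disjoint_QB
  disjoint_QB := h.disjoint_QA
  disjoint_AB := h.disjoint_AB.symm
  subset v hv := by have := h.subset v hv; tauto
  maximal p hyx hQ hS := h.maximal p hyx hQ fun v hv => hS v (by tauto)

theorem not_adj_first (h : IsEar G K c d q q' a a' b b' Q A B) : ¬ G.Adj q a := by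
  intro hqa
  obtain ⟨hcQ, hcA, hcB⟩ := h.c_notMem
  obtain ⟨hdQ, hdA, hdB⟩ := h.d_notMem
  have hQA := Finset.disjoint_left.1 h.disjoint_QA
  have hQB := Finset.disjoint_left.1 h.disjoint_QB
  have hAB := Finset.disjoint_left.1 h.disjoint_AB
  have hne := h.ne
  have hq := h.pathQ.left_mem
  have p := ((((PathOn.single q).append hqa h.pathA
    (Finset.disjoint_left.2 (by grind))).append h.da.symm (.single d)
    (Finset.disjoint_left.2 (by grind))).append h.db h.pathB
    (Finset.disjoint_left.2 (by grind))).append h.cb.symm (.single c)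
    (Finset.disjoint_left.2 (by grind))
  exact h.maximal p h.cq ⟨q, hq, by simp⟩ (by grind)

theorem not_adj_firsts (h : IsEar G K c d q q' a a' b b' Q A B) : ¬ G.Adj a b := by
  intro hab
  obtain ⟨hcQ, hcA, hcB⟩ := h.c_notMem
  obtain ⟨hdQ, hdA, hdB⟩ := h.d_notMem
  have hQA := Finset.disjoint_left.1 h.disjoint_QA
  have hQB := Finset.disjoint_left.1 h.disjoint_QB
  have hAB := Finset.disjoint_left.1 h.disjoint_AB
  have hne := h.ne
  have hq := h.pathQ.left_mem
  have p := ((((PathOn.single c).append h.cq h.pathQ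
    (Finset.disjoint_left.2 (by grind))).append h.dq.symm (.single d)
    (Finset.disjoint_left.2 (by grind))).append h.da h.pathA.symm
    (Finset.disjoint_left.2 (by grind))).append hab h.pathB
    (Finset.disjoint_left.2 (by grind))
  exact h.maximal p h.cb.symm ⟨q, hq, by simp [hq]⟩ (by grind)

theorem notMem_of_mem_path (h : IsEar G K c d q q' a a' b b' Q A B) {v : V} (hv : v ∈ Q) :
    v ∉ K := fun hvK => by
  rcases h.subset v hvK with rfl | rfl | hA | hB
  exacts [h.c_notMem.1 hv, h.d_notMem.1 hv, Finset.disjoint_left.1 h.disjoint_QA hv hA,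
    Finset.disjoint_left.1 h.disjoint_QB hv hB]

theorem ne_arcs (h : IsEar G K c d q q' a a' b b' Q A B) {x y : V} (hx : x ∈ A) (hy : y ∈ B) :
    x ≠ y := fun e => Finset.disjoint_left.1 h.disjoint_AB hx (e ▸ hy)

theorem adj_ends (h : IsEar G K c d q q' a a' b b' Q A B) (hclaw : ClawFree G) :
    G.Adj a b' := by
  by_contra hab
  exact hclaw ⟨c, q, a, b',
    fun e => Finset.disjoint_left.1 h.disjoint_QA h.pathQ.left_mem (e ▸ h.pathA.left_mem),
    fun e => Finset.disjoint_left.1 h.disjoint_QB h.pathQ.left_mem (e ▸ h.pathB.right_mem),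
    h.ne_arcs h.pathA.left_mem h.pathB.right_mem, h.cq, h.ca, h.cb, h.not_adj_first,
    h.rev.not_adj_first, hab⟩

theorem ends_ne (h : IsEar G K c d q q' a a' b b' Q A B) (hclaw : ClawFree G) : a ≠ a' := by
  rintro rfl
  exact h.not_adj_firsts (h.swap.adj_ends hclaw).symm

theorem exists_last (h : IsEar G K c d q q' a a' b b' Q A B) (hclaw : ClawFree G) :
    ∃ y T, PathOn G a y T ∧ G.Adj y a' ∧ a' ∉ T ∧ A = insert a' T ∧ ¬ G.Adj b' y := by
  obtain ⟨y, T, pT, hy, ha', hA⟩ := h.pathA.exists_last (h.ends_ne hclaw)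
  refine ⟨y, T, pT, hy, ha', hA, fun hby => ?_⟩
  obtain ⟨hcQ, hcA, hcB⟩ := h.c_notMem
  obtain ⟨hdQ, hdA, hdB⟩ := h.d_notMem
  have hQA := Finset.disjoint_left.1 h.disjoint_QA
  have hQB := Finset.disjoint_left.1 h.disjoint_QB
  have hAB := Finset.disjoint_left.1 h.disjoint_AB
  have hne := h.ne
  have hq := h.pathQ.left_mem
  have p := (((((PathOn.single c).append h.cq h.pathQ
    (Finset.disjoint_left.2 (by grind))).append h.dq.symm (.single d)
    (Finset.disjoint_left.2 (by grind))).append h.da (.single a')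
    (Finset.disjoint_left.2 (by grind))).append (h.swap.adj_ends hclaw).symm h.pathB
    (Finset.disjoint_left.2 (by grind))).append hby pT.symm
    (Finset.disjoint_left.2 (by grind))
  exact h.maximal p h.ca.symm ⟨q, hq, by simp [hq]⟩ (by grind)

end IsEar

end Ears

section Core

variable {V : Type*} {G : SimpleGraph V}

/-- In a closed claw-free graph, each component of a neighbourhood is a clique. -/
theorem adj_of_adj_of_adj (hclosed : IsClosedGraph G) (hclaw : ClawFree G) {x u v w : V}
    (hu : G.Adj x u) (hv : G.Adj x v) (hw : G.Adj x w) (huv : G.Adj u v) (hvw : G.Adj v w)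
    (huw : u ≠ w) : G.Adj u w := by
  by_contra h
  refine hclosed x ⟨?_, u, w, hu, hw, huw, h⟩
  have hru : (G.induce (G.neighborSet x)).Reachable ⟨v, hv⟩ ⟨u, hu⟩ :=
    SimpleGraph.Adj.reachable huv.symm
  have hrw : (G.induce (G.neighborSet x)).Reachable ⟨v, hv⟩ ⟨w, hw⟩ :=
    SimpleGraph.Adj.reachable hvw
  refine (SimpleGraph.connected_iff_exists_forall_reachable _).2 ⟨⟨v, hv⟩, fun ⟨z, hz⟩ => ?_⟩
  rcases eq_or_ne u z with rfl | hzu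
  · exact hru
  rcases eq_or_ne w z with rfl | hzw
  · exact hrw
  by_cases huz : G.Adj u z
  · exact hru.trans (SimpleGraph.Adj.reachable huz)
  by_cases hwz : G.Adj w z
  · exact hrw.trans (SimpleGraph.Adj.reachable hwz)
  exact absurd ⟨x, u, w, z, huw, hzu, hzw, hu, hw, hz, h, huz, hwz⟩ hclaw

variable [Fintype V] [DecidableEq V]

/-- The properties of a maximum clique `K` of a closed claw-free non-Hamiltonian graph that are
used below. -/
structure IsCore (G : SimpleGraph V) (K : Finset V) : Prop where
  isClique : G.IsClique (K : Set V)
  two_le_card : 2 ≤ K.card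
  three_le_card : ∀ {x y z}, G.Adj x y → G.Adj y z → G.Adj x z → 3 ≤ K.card
  eq_of_adj : ∀ {x k l}, x ∉ K → k ∈ K → l ∈ K → G.Adj x k → G.Adj x l → k = l
  adj_of_adj : ∀ {k x y}, k ∈ K → x ∉ K → y ∉ K → x ≠ y → G.Adj k x → G.Adj k y → G.Adj x y
  card_compl : Kᶜ.card ≤ 6
  not_cycleOn : ¬ CycleOn G Finset.univ

theorem TwoConnected.exists_adj (h : TwoConnected G) (v : V) : ∃ w, G.Adj v w := by
  obtain ⟨u, hu⟩ : ∃ u, u ≠ v := Fintype.exists_ne_of_one_lt_card (by have := h.1; omega) v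
  obtain ⟨t, htu, htv⟩ : ∃ t, t ≠ u ∧ t ≠ v := by
    obtain ⟨t, ht⟩ : ∃ t, t ∉ ({u, v} : Finset V) := by
      refine not_forall.1 fun hall => ?_
      have := Finset.card_le_two (a := u) (b := v)
      rw [Finset.eq_univ_iff_forall.2 hall, Finset.card_univ] at this
      have := h.1
      omega
    exact ⟨t, by simpa using ht⟩
  have : Nontrivial ({u}ᶜ : Set V) := ⟨⟨v, hu.symm⟩, ⟨t, htu⟩, fun e => htv (congrArg Subtype.val e.symm)⟩
  obtain ⟨w, hw⟩ := (h.2 u).preconnected.exists_adj_of_nontrivial ⟨v, hu.symm⟩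
  exact ⟨w, hw⟩

theorem exists_isCore (h2 : TwoConnected G) (hclosed : IsClosedGraph G) (hclaw : ClawFree G)
    (hham : ¬ G.IsHamiltonian) (hclique : G.cliqueNum ≥ Fintype.card V - 6) :
    ∃ K, IsCore G K := by
  obtain ⟨K, hK⟩ := G.exists_isNClique_cliqueNum
  have hmax : ∀ T : Finset V, G.IsClique (T : Set V) → T.card ≤ K.card := fun T hT => by
    rw [hK.card_eq]
    exact hT.card_le_cliqueNum
  have h2K : 2 ≤ K.card := by
    have : 0 < Fintype.card V := by have := h2.1; omega
    obtain ⟨v⟩ := Fintype.card_pos_iff.1 this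
    obtain ⟨w, hw⟩ := h2.exists_adj v
    have := hmax {v, w} (by simp [SimpleGraph.isClique_insert, hw])
    rwa [Finset.card_pair hw.ne] at this
  have heq : ∀ {x k l}, x ∉ K → k ∈ K → l ∈ K → G.Adj x k → G.Adj x l → k = l := by
    intro x k l hx hk hl hxk hxl
    by_contra hkl
    have := hmax (insert x K) ?_
    · rw [Finset.card_insert_of_notMem hx] at this
      omega
    rw [Finset.coe_insert, SimpleGraph.isClique_insert]
    refine ⟨hK.isClique, fun z hz hxz => ?_⟩
    rcases eq_or_ne z k with rfl | hzk
    · exact hxk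
    rcases eq_or_ne z l with rfl | hzl
    · exact hxl
    exact adj_of_adj_of_adj hclosed hclaw hxk.symm (hK.isClique hk hl hkl)
      (hK.isClique hk hz hzk.symm) hxl (hK.isClique hl hz hzl.symm) hxz
  refine ⟨K, hK.isClique, h2K, fun {x y z} hxy hyz hxz => ?_, heq, ?_, ?_,
    fun h => hham (h.isHamiltonian h2.1)⟩
  · have := hmax {x, y, z} (by simp [SimpleGraph.isClique_insert, hxy, hyz, hxz])
    rwa [Finset.card_eq_three.2 ⟨x, y, z, hxy.ne, hxz.ne, hyz.ne, rfl⟩] at this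
  · intro k x y hk hx hy hxy hkx hky
    by_contra hnxy
    obtain ⟨l, hl, hlk⟩ := Finset.exists_mem_ne (s := K) (by omega) k
    exact hclaw ⟨k, l, x, y, by rintro rfl; exact hx hl, by rintro rfl; exact hy hl, hxy,
      hK.isClique hk hl hlk.symm, hkx, hky,
      fun h => hlk (heq hx hl hk h.symm hkx.symm), fun h => hlk (heq hy hl hk h.symm hky.symm), hnxy⟩
  · rw [Finset.card_compl, hK.card_eq]
    omega

theorem IsCore.false_of_path {K : Finset V} (hK : IsCore G K) {k k' r r' : V} (hk : k ∈ K)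
    (hk' : k' ∈ K) (hne : k ≠ k') (hr : G.Adj k r) (p : PathOn G r r' Kᶜ) (hr' : G.Adj r' k') :
    False :=
  hK.not_cycleOn ⟨k', r', Finset.union_compl K ▸
    (pathOn_of_isClique hK.isClique hk' hk hne.symm).append hr p disjoint_compl_right, hr'⟩

theorem IsCore.false_of_isChain {K : Finset V} (hK : IsCore G K) {k k' x : V} {l : List V}
    (hk : k ∈ K) (hk' : k' ∈ K) (hne : k ≠ k') (hmem : ∀ v, v ∉ K ↔ v ∈ x :: l)
    (hcard : Kᶜ.card = (x :: l).length) (hl : (k :: x :: l ++ [k']).IsChain G.Adj) : False := by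
  have hKl : (x :: l).toFinset = Kᶜ := by
    ext v
    rw [List.mem_toFinset, ← hmem, Finset.mem_compl]
  have hn : (x :: l).Nodup := by
    rw [← hKl] at hcard
    exact Multiset.toFinset_card_eq_card_iff_nodup.1 hcard
  rw [List.cons_append, List.cons_append, List.isChain_cons_cons, ← List.cons_append,
    List.isChain_append] at hl
  have p := pathOn_of_isChain hl.2.1 hn
  rw [hKl] at p
  exact hK.false_of_path hk hk' hne hl.1 p
    (hl.2.2.2 _ (List.getLast_mem_getLast? _) _ rfl)

theorem IsCore.false_of_two_paths {K R S : Finset V} (hK : IsCore G K)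
    {k₁ k₂ k₃ k₄ r r' s s' : V} (h₁ : k₁ ∈ K) (h₂ : k₂ ∈ K) (h₃ : k₃ ∈ K) (h₄ : k₄ ∈ K)
    (hn : [k₁, k₂, k₃, k₄].Nodup) (hr : G.Adj k₁ r) (p : PathOn G r r' R) (hr' : G.Adj r' k₂)
    (hs : G.Adj k₃ s) (q : PathOn G s s' S) (hs' : G.Adj s' k₄) (hRS : Disjoint R S)
    (hKRS : R ∪ S = Kᶜ) : False := by
  simp only [List.nodup_cons, List.mem_cons, not_or, List.not_mem_nil, not_false_eq_true,
    List.nodup_nil, and_true] at hn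
  obtain ⟨⟨h12, h13, h14⟩, ⟨h23, h24⟩, h34⟩ := hn
  have hR : ∀ v ∈ R, v ∉ K := fun v hv => by
    rw [← Finset.mem_compl, ← hKRS]; exact Finset.mem_union_left _ hv
  have hS : ∀ v ∈ S, v ∉ K := fun v hv => by
    rw [← Finset.mem_compl, ← hKRS]; exact Finset.mem_union_right _ hv
  have p₀ : PathOn G k₂ k₃ (K \ {k₁, k₄}) :=
    pathOn_of_isClique (hK.isClique.subset (by simp))
      (by simp [h₂, Ne.symm h12, h24]) (by simp [h₃, Ne.symm h13, h34]) h23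
  have p₁ := p₀.append hs q (Finset.disjoint_left.2 fun v hv hv' => hS v hv' (by simp_all))
  have p₂ := p₁.append hs' (.single k₄) (by simpa using fun h => hS _ h h₄)
  have p₃ := p₂.append (hK.isClique h₄ h₁ (Ne.symm h14)) (.single k₁)
    (by simpa [h14] using fun h => hS _ h h₁)
  have p₄ := p₃.append hr p (by
    simp only [Finset.disjoint_union_left, Finset.disjoint_singleton_left]
    refine ⟨⟨⟨Finset.disjoint_left.2 fun v hv hv' => hR v hv' (by simp_all), hRS.symm⟩,
      fun h => hR _ h h₄⟩, fun h => hR _ h h₁⟩)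
  refine hK.not_cycleOn ⟨k₂, r', ?_, hr'⟩
  convert p₄ using 1
  ext v
  have : v ∈ R ∪ S ↔ v ∉ K := by rw [hKRS, Finset.mem_compl]
  simp only [Finset.mem_univ, Finset.mem_union, Finset.mem_sdiff, Finset.mem_insert,
    Finset.mem_singleton, true_iff] at this ⊢
  tauto

/-- The vertices outside `K` are `bᵢ, mᵢ`; the `bᵢ` form a triangle which is joined to three
vertices `aᵢ` of `K` by the paths `aᵢmᵢbᵢ`. -/
structure IsTriangleTheta (G : SimpleGraph V) (K : Finset V) (a b m : Fin 3 → V) : Prop where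
  a_mem : ∀ i, a i ∈ K
  a_ne : ∀ i j, i ≠ j → a i ≠ a j
  b_adj : ∀ i j, i ≠ j → G.Adj (b i) (b j)
  am_adj : ∀ i, G.Adj (a i) (m i)
  bm_adj : ∀ i, G.Adj (b i) (m i)
  notMem_iff : ∀ v, v ∉ K ↔ ∃ i, v = b i ∨ v = m i
  card_compl : Kᶜ.card = 6

theorem IsTriangleTheta.isFrame {K : Finset V} {a b m : Fin 3 → V}
    (h : IsTriangleTheta G K a b m) (hK : IsCore G K) : IsFrame G K a b m := by
  have hb : ∀ i, b i ∉ K := fun i => (h.notMem_iff _).2 ⟨i, .inl rfl⟩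
  have hm : ∀ i, m i ∉ K := fun i => (h.notMem_iff _).2 ⟨i, .inr rfl⟩
  have hthird : ∀ i j : Fin 3, i ≠ j → ∃ l, i ≠ l ∧ j ≠ l ∧ ∀ t, t = i ∨ t = j ∨ t = l := by
    decide
  have hlist : ∀ i j l : Fin 3, (∀ t, t = i ∨ t = j ∨ t = l) → ∀ v, v ∉ K ↔
      v = b i ∨ v = m i ∨ v = b j ∨ v = m j ∨ v = b l ∨ v = m l := by
    intro i j l ht v
    rw [h.notMem_iff]
    constructor
    · rintro ⟨t, hv⟩
      rcases ht t with rfl | rfl | rfl <;> tauto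
    · rintro (hv | hv | hv | hv | hv | hv)
      exacts [⟨i, .inl hv⟩, ⟨i, .inr hv⟩, ⟨j, .inl hv⟩, ⟨j, .inr hv⟩, ⟨l, .inl hv⟩, ⟨l, .inr hv⟩]
  have hmb : ∀ i j, i ≠ j → ¬ G.Adj (m i) (b j) := by
    intro i j hij hadj
    obtain ⟨l, hil, hjl, ht⟩ := hthird i j hij
    refine hK.false_of_isChain (k := a j) (x := m j) (l := [b j, m i, b i, b l, m l]) (k' := a l)
      (h.a_mem _) (h.a_mem _) (h.a_ne _ _ hjl) (fun v => ?_) h.card_compl ?_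
    · rw [hlist i j l ht]
      simp only [List.mem_cons, List.not_mem_nil, or_false]
      tauto
    · simp [h.am_adj, (h.am_adj _).symm, h.bm_adj, (h.bm_adj _).symm, hadj.symm, h.b_adj _ _ hil]
  have hmm : ∀ i j, ¬ G.Adj (m i) (m j) := by
    intro i j hadj
    obtain ⟨l, hil, hjl, ht⟩ := hthird i j fun e => hadj.ne (by rw [e])
    refine hK.false_of_isChain (k := a i) (x := m i) (l := [m j, b j, b i, b l, m l]) (k' := a l)
      (h.a_mem _) (h.a_mem _) (h.a_ne _ _ hil) (fun v => ?_) h.card_compl ?_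
    · rw [hlist i j l ht]
      simp only [List.mem_cons, List.not_mem_nil, or_false]
      tauto
    · have hij : j ≠ i := fun e => hadj.ne (by rw [e])
      simp [h.am_adj, (h.am_adj _).symm, h.bm_adj, (h.bm_adj _).symm, hadj, h.b_adj _ _ hil,
        h.b_adj _ _ hij]
  have hbK : ∀ i, ∀ k ∈ K, k ≠ a i → ¬ G.Adj k (b i) := by
    intro i k hk hki hadj
    by_cases hka : ∃ j, k = a j
    · obtain ⟨j, rfl⟩ := hka
      have hji : j ≠ i := fun e => hki (by rw [e])
      obtain ⟨l, hjl, hil, -⟩ := hthird j i hji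
      exact hmb j i hji (hK.adj_of_adj hk (hm j) (hb i)
        (fun e => hmb j l hjl (e ▸ h.b_adj i l hil)) (h.am_adj j) hadj)
    · push Not at hka
      obtain ⟨j, hij⟩ : ∃ j, i ≠ j := (exists_ne i).imp fun _ => Ne.symm
      obtain ⟨l, hil, hjl, ht⟩ := hthird i j hij
      have hKc : [m i, b i, m j, b j, b l, m l].toFinset = Kᶜ := by
        ext v
        rw [Finset.mem_compl, hlist i j l ht]
        simp only [List.mem_toFinset, List.mem_cons, List.not_mem_nil, or_false]
        tauto
      have hn : [m i, b i, m j, b j, b l, m l].Nodup := by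
        refine Multiset.toFinset_card_eq_card_iff_nodup.1 (?_ : (List.toFinset _).card = _)
        rw [hKc, h.card_compl]
        rfl
      have hn' := (List.nodup_append (l₁ := [m i, b i]) (l₂ := [m j, b j, b l, m l])).1 hn
      refine hK.false_of_two_paths (h.a_mem i) hk (h.a_mem j) (h.a_mem l) ?_ (h.am_adj i)
        (pathOn_of_isChain (l := [b i]) (by simp [(h.bm_adj i).symm]) hn'.1) hadj.symm
        (h.am_adj j) (pathOn_of_isChain (l := [b j, b l, m l])
          (by simp [h.bm_adj, (h.bm_adj _).symm, h.b_adj _ _ hjl]) hn'.2.1) (h.am_adj l).symm ?_ ?_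
      · simp [hki.symm, hka, h.a_ne _ _ hij, h.a_ne _ _ hil, h.a_ne _ _ hjl]
      · exact List.disjoint_toFinset_iff_disjoint.2 fun v h₁ h₂ => hn'.2.2 v h₁ v h₂ rfl
      · rw [← hKc, ← List.toFinset_append]
        rfl
  have hmK : ∀ i, ∀ k ∈ K, k ≠ a i → ¬ G.Adj k (m i) := fun i k hk hki hadj =>
    hki (hK.eq_of_adj (hm i) hk (h.a_mem i) hadj.symm (h.am_adj i).symm)
  refine ⟨fun i j hij => hK.isClique (h.a_mem i) (h.a_mem j) (h.a_ne i j hij), h.b_adj, h.am_adj,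
    h.bm_adj, fun i j hij => hbK j _ (h.a_mem i) (h.a_ne i j hij),
    fun i j hij => hmK j _ (h.a_mem i) (h.a_ne i j hij), fun i j hij e => hmb j i hij.symm e.symm,
    hmm, fun v hv => ?_, fun k hk hne v hv => ?_⟩
  · obtain ⟨i, hi⟩ := (h.notMem_iff v).1 hv
    exact ⟨i, .inr hi⟩
  · obtain ⟨i, rfl | rfl⟩ := (h.notMem_iff v).1 hv
    exacts [hbK i k hk (hne i).1, hmK i k hk (hne i).1]

/-- The vertices outside `K` are `α, α', β, β', μ, μ'`; together with `x, y ∈ K` they form the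
triangles `xαα'`, `yββ'` and the paths `αμβ`, `α'μ'β'`. -/
structure IsEdgeTheta (G : SimpleGraph V) (K : Finset V) (x y α α' β β' μ μ' : V) : Prop where
  x_mem : x ∈ K
  y_mem : y ∈ K
  ne : x ≠ y
  left : G.Adj x α
  left' : G.Adj x α'
  left_adj : G.Adj α α'
  right : G.Adj y β
  right' : G.Adj y β'
  right_adj : G.Adj β β'
  left_mid : G.Adj α μ
  left_mid' : G.Adj α' μ'
  right_mid : G.Adj β μ
  right_mid' : G.Adj β' μ'
  notMem_iff : ∀ v, v ∉ K ↔ v ∈ [α, α', β, β', μ, μ']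
  card_compl : Kᶜ.card = 6

namespace IsEdgeTheta

variable {K : Finset V} {x y α α' β β' μ μ' : V}

theorem swap (h : IsEdgeTheta G K x y α α' β β' μ μ') :
    IsEdgeTheta G K x y α' α β' β μ' μ where
  x_mem := h.x_mem
  y_mem := h.y_mem
  ne := h.ne
  left := h.left'
  left' := h.left
  left_adj := h.left_adj.symm
  right := h.right'
  right' := h.right
  right_adj := h.right_adj.symm
  left_mid := h.left_mid'
  left_mid' := h.left_mid
  right_mid := h.right_mid'
  right_mid' := h.right_mid
  notMem_iff v := by
    rw [h.notMem_iff]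
    simp only [List.mem_cons, List.not_mem_nil, or_false]
    tauto
  card_compl := h.card_compl

theorem flip (h : IsEdgeTheta G K x y α α' β β' μ μ') :
    IsEdgeTheta G K y x β β' α α' μ μ' where
  x_mem := h.y_mem
  y_mem := h.x_mem
  ne := h.ne.symm
  left := h.right
  left' := h.right'
  left_adj := h.right_adj
  right := h.left
  right' := h.left'
  right_adj := h.left_adj
  left_mid := h.right_mid
  left_mid' := h.right_mid'
  right_mid := h.left_mid
  right_mid' := h.left_mid'
  notMem_iff v := by
    rw [h.notMem_iff]
    simp only [List.mem_cons, List.not_mem_nil, or_false]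
    tauto
  card_compl := h.card_compl

theorem false_of_isChain (h : IsEdgeTheta G K x y α α' β β' μ μ') (hK : IsCore G K) {k k' r : V}
    {l : List V} (hk : k ∈ K) (hk' : k' ∈ K) (hne : k ≠ k')
    (hl : (r :: l).Perm [α, α', β, β', μ, μ']) (hc : (k :: r :: l ++ [k']).IsChain G.Adj) :
    False :=
  hK.false_of_isChain hk hk' hne (fun v => by rw [h.notMem_iff, hl.mem_iff])
    (by rw [h.card_compl, hl.length_eq]; rfl) hc

theorem not_adj_left_mid' (h : IsEdgeTheta G K x y α α' β β' μ μ') (hK : IsCore G K) :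
    ¬ G.Adj α μ' := fun hadj =>
  h.false_of_isChain hK h.x_mem h.y_mem h.ne (r := α') (l := [μ', α, μ, β, β'])
    (by rw [List.perm_iff_count]; intro a; simp only [List.count_cons]; omega)
    (by simp [h.left', h.left_mid', hadj.symm, h.left_mid, h.right_mid.symm, h.right_adj,
      h.right'.symm])

theorem not_adj_left_right' (h : IsEdgeTheta G K x y α α' β β' μ μ') (hK : IsCore G K) :
    ¬ G.Adj α β' := fun hadj =>
  h.false_of_isChain hK h.x_mem h.y_mem h.ne (r := α') (l := [μ', β', α, μ, β])
    (by rw [List.perm_iff_count]; intro a; simp only [List.count_cons]; omega)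
    (by simp [h.left', h.left_mid', h.right_mid'.symm, hadj.symm, h.left_mid, h.right_mid.symm,
      h.right.symm])

theorem not_adj_mid_mid' (h : IsEdgeTheta G K x y α α' β β' μ μ') (hK : IsCore G K) :
    ¬ G.Adj μ μ' := fun hadj =>
  h.false_of_isChain hK h.x_mem h.y_mem h.ne (r := α) (l := [α', μ', μ, β, β'])
    (by rw [List.perm_iff_count]; intro a; simp only [List.count_cons]; omega)
    (by simp [h.left, h.left_adj, h.left_mid', hadj.symm, h.right_mid.symm, h.right_adj,
      h.right'.symm])

theorem not_adj_mid (h : IsEdgeTheta G K x y α α' β β' μ μ') (hK : IsCore G K) {k : V}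
    (hk : k ∈ K) : ¬ G.Adj k μ := by
  have key : ∀ {x y α α' β β'}, IsEdgeTheta G K x y α α' β β' μ μ' → k ≠ x → ¬ G.Adj k μ := by
    intro x y α α' β β' h hkx hadj
    exact h.false_of_isChain hK h.x_mem hk hkx.symm (r := α) (l := [α', μ', β', β, μ])
      (by rw [List.perm_iff_count]; intro a; simp only [List.count_cons]; omega)
      (by simp [h.left, h.left_adj, h.left_mid', h.right_mid'.symm, h.right_adj.symm,
        h.right_mid, hadj.symm])
  rcases eq_or_ne k x with rfl | hkx
  · exact key h.flip h.ne
  · exact key h hkx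

theorem not_adj_left (h : IsEdgeTheta G K x y α α' β β' μ μ') (hK : IsCore G K) {k : V}
    (hk : k ∈ K) (hkx : k ≠ x) : ¬ G.Adj k α := fun hadj =>
  hkx (hK.eq_of_adj ((h.notMem_iff α).2 (by simp)) hk h.x_mem hadj.symm h.left.symm)

theorem isFrame (h : IsEdgeTheta G K x y α α' β β' μ μ') (hK : IsCore G K) {z : V} (hz : z ∈ K)
    (hzx : z ≠ x) (hzy : z ≠ y) : IsFrame G K ![α, α', x] ![β, β', y] ![μ, μ', z] := by
  have hxz := hK.isClique h.x_mem hz hzx.symm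
  have hyz := hK.isClique h.y_mem hz hzy.symm
  have hl := fun k => h.not_adj_left hK (k := k)
  have hl' := fun k => h.swap.not_adj_left hK (k := k)
  have hr := fun k => h.flip.not_adj_left hK (k := k)
  have hr' := fun k => h.flip.swap.not_adj_left hK (k := k)
  have hm : ∀ k ∈ K, ¬ G.Adj k μ := fun k hk => h.not_adj_mid hK hk
  have hm' : ∀ k ∈ K, ¬ G.Adj k μ' := fun k hk => h.swap.not_adj_mid hK hk
  have hsymm : ∀ {u v}, ¬ G.Adj u v → ¬ G.Adj v u := fun h e => h e.symm
  constructor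
  · simp [Fin.forall_fin_succ, h.left, h.left', h.left_adj, h.left.symm, h.left'.symm,
      h.left_adj.symm]
  · simp [Fin.forall_fin_succ, h.right, h.right', h.right_adj, h.right.symm, h.right'.symm,
      h.right_adj.symm]
  · simp [Fin.forall_fin_succ, h.left_mid, h.left_mid', hxz]
  · simp [Fin.forall_fin_succ, h.right_mid, h.right_mid', hyz]
  · simp [Fin.forall_fin_succ, h.not_adj_left_right' hK, h.swap.not_adj_left_right' hK,
      hsymm (hl y h.y_mem h.ne.symm), hsymm (hl' y h.y_mem h.ne.symm), hr x h.x_mem h.ne,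
      hr' x h.x_mem h.ne]
  · simp [Fin.forall_fin_succ, h.not_adj_left_mid' hK, h.swap.not_adj_left_mid' hK,
      hsymm (hl z hz hzx), hsymm (hl' z hz hzx), hm x h.x_mem, hm' x h.x_mem]
  · simp [Fin.forall_fin_succ, h.flip.not_adj_left_mid' hK, h.flip.swap.not_adj_left_mid' hK,
      hsymm (hr z hz hzy), hsymm (hr' z hz hzy), hm y h.y_mem, hm' y h.y_mem]
  · simp [Fin.forall_fin_succ, h.not_adj_mid_mid' hK, hsymm (h.not_adj_mid_mid' hK), hm z hz,
      hm' z hz, hsymm (hm z hz), hsymm (hm' z hz)]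
  · intro v hv
    have := (h.notMem_iff v).1 hv
    simp only [List.mem_cons, List.not_mem_nil, or_false] at this
    simp only [Fin.exists_fin_succ, Matrix.cons_val_zero, Matrix.cons_val_succ,
      IsEmpty.exists_iff, or_false]
    tauto
  · intro k hk hne v hv
    have hkx := (hne 2).1
    have hky := (hne 2).2.1
    have := (h.notMem_iff v).1 hv
    simp only [List.mem_cons, List.not_mem_nil, or_false] at this
    rcases this with rfl | rfl | rfl | rfl | rfl | rfl
    exacts [hl k hk hkx, hl' k hk hkx, hr k hk hky, hr' k hk hky, hm k hk, hm' k hk]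

end IsEdgeTheta

theorem TwoConnected.exists_pathOn (h2 : TwoConnected G) {S : Finset V} {q c v : V} (hq : q ∉ S)
    (hv : v ∈ S) (hc : c ∈ S) (hcv : c ≠ v) :
    ∃ d ∈ S, d ≠ v ∧ ∃ q' Q, PathOn G q q' Q ∧ Disjoint Q S ∧ G.Adj q' d := by
  have hqv : q ≠ v := fun e => hq (e ▸ hv)
  obtain ⟨w⟩ := (h2.2 v).preconnected ⟨q, hqv⟩ ⟨c, hcv⟩
  have key : ∀ {x y : ({v}ᶜ : Set V)}, (G.induce ({v}ᶜ : Set V)).Walk x y → (y : V) ∈ S →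
      (x : V) ∉ S → ∃ d ∈ S, d ≠ v ∧ ∃ q' Q, PathOn G (x : V) q' Q ∧ Disjoint Q S ∧ G.Adj q' d := by
    intro x y w hy
    induction w with
    | nil => exact fun hx => absurd hy hx
    | @cons x z y hxz _ ih =>
      intro hx
      by_cases hz : (z : V) ∈ S
      · exact ⟨z, hz, z.2, x, {(x : V)}, .single _, by simpa using hx, hxz⟩
      · obtain ⟨d, hd, hdv, q', Q, hQ, hQS, hq'd⟩ := ih hy hz
        obtain ⟨Q', hQ', hQS'⟩ := PathOn.reroot (p := (x : V)) hxz hx hQ hQS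
        exact ⟨d, hd, hdv, q', Q', hQ', hQS', hq'd⟩
  exact key w hc hq

theorem exists_isEar (h2 : TwoConnected G) {K : Finset V} (hK : IsCore G K) :
    ∃ c d q q' a a' b b' Q A B, IsEar G K c d q q' a a' b b' Q A B := by
  classical
  have hcycK : CycleOn G K := by
    obtain ⟨x, hx, y, hy, hxy⟩ := Finset.one_lt_card.1 hK.two_le_card
    exact ⟨x, y, pathOn_of_isClique hK.isClique hx hy hxy, hK.isClique hy hx hxy.symm⟩
  obtain ⟨S, hKS, hS⟩ := (Set.toFinite {S | CycleOn G S}).exists_le_maximal hcycK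
  have hmax : ∀ {x y T}, PathOn G x y T → G.Adj y x → (∃ v ∈ T, v ∉ S) → ¬ S ⊆ T :=
    fun p hyx ⟨v, hv, hvS⟩ hST => hvS (hS.2 ⟨_, _, p, hyx⟩ hST hv)
  obtain ⟨q₀, hq₀⟩ : ∃ q, q ∉ S := by
    by_contra! h
    exact hK.not_cycleOn (Finset.eq_univ_iff_forall.2 h ▸ hS.1)
  obtain ⟨u, hu, v, hv, huv⟩ := Finset.one_lt_card.1
    (hK.two_le_card.trans (Finset.card_le_card hKS))
  obtain ⟨c, hc, hcv, q, Q₀, hQ₀, hQS₀, hqc⟩ := h2.exists_pathOn hq₀ hv hu huv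
  have hqS : q ∉ S := Finset.disjoint_left.1 hQS₀ hQ₀.right_mem
  obtain ⟨d, hd, hdc, q', Q, hQ, hQS, hqd⟩ := h2.exists_pathOn hqS hc hv hcv.symm
  rcases CycleOn.split hS.1 hc hd hdc.symm with p |
    ⟨a, a', b, b', A, B, hca, pA, hda, hdb, pB, hcb, hcA, hcB, hdA, hdB, hAB, rfl⟩
  · exact absurd Finset.subset_union_left (hmax (p.append hqd.symm hQ.symm hQS.symm) hqc
      ⟨q, Finset.mem_union_right _ hQ.left_mem, hqS⟩)
  · simp only [Finset.disjoint_insert_right, Finset.disjoint_union_right] at hQS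
    refine ⟨c, d, q, q', a, a', b, b', Q, A, B, hqc.symm, hqd.symm, hca, hda.symm, hdb, hcb.symm,
      hQ, pA, pB, hdc.symm, ⟨hQS.1, hcA, hcB⟩, ⟨hQS.2.1, hdA, hdB⟩, hQS.2.2.1, hQS.2.2.2, hAB,
      fun v hv => by simpa using hKS hv, fun p hyx ⟨v, hvQ, hvS⟩ hsub => ?_⟩
    refine hmax p hyx ⟨v, hvS, ?_⟩ fun v hv => hsub v (by simpa using hv)
    rw [Finset.disjoint_left, Finset.disjoint_left] at hQS
    simp only [Finset.mem_insert, Finset.mem_union, not_or]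
    exact ⟨fun e => hQS.1 (e ▸ hvQ), fun e => hQS.2.1 (e ▸ hvQ), hQS.2.2.1 hvQ, hQS.2.2.2 hvQ⟩

theorem IsCore.notMem_iff_of_nodup {K : Finset V} (hK : IsCore G K) {l : List V} (hn : l.Nodup)
    (hl : ∀ v ∈ l, v ∉ K) (h6 : l.length = 6) : (∀ v, v ∉ K ↔ v ∈ l) ∧ Kᶜ.card = 6 := by
  have hc : l.toFinset.card = 6 := by rw [List.toFinset_card_of_nodup hn, h6]
  have hs : l.toFinset = Kᶜ :=
    Finset.eq_of_subset_of_card_le (fun v hv => by simpa using hl v (by simpa using hv))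
      (by rw [hc]; exact hK.card_compl)
  exact ⟨fun v => by rw [← Finset.mem_compl, ← hs, List.mem_toFinset], hs ▸ hc⟩

namespace IsEar

variable {K : Finset V} {c d q q' a a' b b' : V} {Q A B : Finset V}

theorem first_mem (h : IsEar G K c d q q' a a' b b' Q A B) (hK : IsCore G K) (hc : c ∈ K) :
    a ∈ K := by
  by_contra ha
  have hq := h.pathQ.left_mem
  exact h.not_adj_first (hK.adj_of_adj hc (h.notMem_of_mem_path hq) ha
    (fun e => Finset.disjoint_left.1 h.disjoint_QA hq (e ▸ h.pathA.left_mem)) h.cq h.ca)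

theorem exists_isTriangleTheta (h : IsEar G K c d q q' a a' b b' Q A B) (hK : IsCore G K)
    (hclaw : ClawFree G) (hc : c ∈ K) : ∃ a b m, IsTriangleTheta G K a b m := by
  have haA := h.pathA.left_mem
  have ha'A := h.pathA.right_mem
  have hbB := h.pathB.left_mem
  have hb'B := h.pathB.right_mem
  have ha := h.first_mem hK hc
  have hb' := h.rev.first_mem hK hc
  have hd : d ∉ K := fun hd => h.not_adj_firsts
    (hK.isClique ha (h.swap.first_mem hK hd) (h.ne_arcs haA hbB))
  have ha' : a' ∉ K := fun ha' => h.rev.not_adj_firsts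
    (hK.isClique hb' ha' (h.ne_arcs ha'A hb'B).symm)
  have hb : b ∉ K := fun hb => h.not_adj_firsts (hK.isClique ha hb (h.ne_arcs haA hbB))
  obtain ⟨y, T, pT, hya', ha'T, hAT, hb'y⟩ := h.exists_last hclaw
  obtain ⟨z, U, pU, hzb, hbU, hBU, haz⟩ := h.rev.exists_last hclaw
  have hTA : T ⊆ A := hAT ▸ Finset.subset_insert _ _
  have hUB : U ⊆ B := hBU ▸ Finset.subset_insert _ _
  have hyA := hTA pT.right_mem
  have hzB := hUB pU.right_mem
  have hy : y ∉ K := fun hy => hb'y (hK.isClique hb' hy (h.ne_arcs hyA hb'B).symm)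
  have hz : z ∉ K := fun hz => haz (hK.isClique ha hz (h.ne_arcs haA hzB))
  obtain ⟨x, W, pW, hxy, hyW, hTW⟩ := pT.exists_last fun e => hy (e ▸ ha)
  obtain ⟨w, X, pX, hwz, hzX, hUX⟩ := pU.exists_last fun e => hz (e ▸ hb')
  have hxT : x ∈ T := hTW ▸ Finset.mem_insert_of_mem pW.right_mem
  have hwU : w ∈ U := hUX ▸ Finset.mem_insert_of_mem pX.right_mem
  have hxA := hTA hxT
  have hwB := hUB hwU
  have hAB := Finset.disjoint_left.1 h.disjoint_AB
  have hQA := Finset.disjoint_left.1 h.disjoint_QA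
  have hQB := Finset.disjoint_left.1 h.disjoint_QB
  have hcn := h.c_notMem
  have hdn := h.d_notMem
  have hya'_ne := hya'.ne
  have hzb_ne := hzb.ne
  have hxy_ne := hxy.ne
  have hwz_ne := hwz.ne
  have hqQ := h.pathQ.left_mem
  have hq'Q := h.pathQ.right_mem
  have hq := h.notMem_of_mem_path hqQ
  have hq' := h.notMem_of_mem_path hq'Q
  obtain ⟨hmem, hcard⟩ := hK.notMem_iff_of_nodup (l := [d, a', b, q, y, z])
    (by simp only [List.nodup_cons, List.mem_cons, List.not_mem_nil]; grind) (by simp [*]) rfl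
  have hx : x ∈ K := by
    by_contra hx
    have := (hmem x).1 hx
    grind
  have hw : w ∈ K := by
    by_contra hw
    have := (hmem w).1 hw
    grind
  obtain rfl : q' = q := by
    have := (hmem q').1 hq'
    grind
  refine ⟨![c, x, w], ![d, a', b], ![q', y, z], ?_, ?_, ?_, ?_, ?_, fun v => ?_, hcard⟩
  · simp [Fin.forall_fin_succ, hc, hx, hw]
  · have hcx : c ≠ x := by grind
    have hcw : c ≠ w := by grind
    have hxw : x ≠ w := by grind
    simp [Fin.forall_fin_succ, hcx, hcw, hxw, hcx.symm, hcw.symm, hxw.symm]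
  · have := h.swap.adj_ends hclaw
    simp [Fin.forall_fin_succ, h.da, h.db, h.da.symm, h.db.symm, this, this.symm]
  · simp [Fin.forall_fin_succ, h.cq, hxy, hwz]
  · simp [Fin.forall_fin_succ, h.dq, hya'.symm, hzb.symm]
  · rw [hmem]
    simp only [Fin.exists_fin_succ, Matrix.cons_val_zero, Matrix.cons_val_succ,
      IsEmpty.exists_iff, or_false, List.mem_cons, List.not_mem_nil]
    clear * -
    tauto

theorem exists_isEdgeTheta_of_mem (h : IsEar G K c d q q' a a' b b' Q A B) (hK : IsCore G K)
    (hclaw : ClawFree G) (hc : c ∉ K) (hd : d ∉ K) (ha : a ∈ K) :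
    ∃ x y α α' β β' μ μ', IsEdgeTheta G K x y α α' β β' μ μ' := by
  have haA := h.pathA.left_mem
  have ha'A := h.pathA.right_mem
  have hbB := h.pathB.left_mem
  have hb'B := h.pathB.right_mem
  have hAB := Finset.disjoint_left.1 h.disjoint_AB
  have hQA := Finset.disjoint_left.1 h.disjoint_QA
  have hQB := Finset.disjoint_left.1 h.disjoint_QB
  have hcn := h.c_notMem
  have hdn := h.d_notMem
  have hne := h.ne
  have hb : b ∉ K := fun hb => h.not_adj_firsts (hK.isClique ha hb (h.ne_arcs haA hbB))
  have hb' : b' ∉ K := fun hb' => h.ne_arcs haA hb'B (hK.eq_of_adj hc ha hb' h.ca h.cb)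
  have hbb' : b ≠ b' := h.swap.ends_ne hclaw
  obtain ⟨y, T, pT, hyb, hbT, hBT, hay⟩ := h.rev.exists_last hclaw
  have hyB : y ∈ B := hBT ▸ Finset.mem_insert_of_mem pT.right_mem
  have hyK : y ∉ K := fun hy => hay (hK.isClique ha hy (h.ne_arcs haA hyB))
  have hyb' : y ≠ b' := fun e => hay (e ▸ h.adj_ends hclaw)
  have hqQ := h.pathQ.left_mem
  have hq'Q := h.pathQ.right_mem
  have hq := h.notMem_of_mem_path hqQ
  have hq' := h.notMem_of_mem_path hq'Q
  have hyb_ne := hyb.ne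
  obtain ⟨hmem, hcard⟩ := hK.notMem_iff_of_nodup (l := [c, b', d, b, q, y])
    (by simp only [List.nodup_cons, List.mem_cons, List.not_mem_nil]; grind) (by simp [*]) rfl
  have ha' : a' ∈ K := by
    by_contra ha'
    have := (hmem a').1 ha'
    grind
  have hyy : G.Adj y b' := by
    obtain ⟨z, U, pU, hzb', hb'U, hBU, ha'z⟩ := h.swap.exists_last hclaw
    have hzB : z ∈ B := hBU ▸ Finset.mem_insert_of_mem pU.right_mem
    have hzK : z ∉ K := fun hz => ha'z (hK.isClique ha' hz (h.ne_arcs ha'A hzB))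
    have hzb : z ≠ b := fun e => ha'z (e ▸ (h.swap.adj_ends hclaw).symm)
    have hz := (hmem z).1 hzK
    have hzb'_ne := hzb'.ne
    obtain rfl : z = y := by grind
    exact hzb'
  obtain rfl : q' = q := by
    have := (hmem q').1 hq'
    grind
  exact ⟨a, a', c, b', d, b, q', y, ha, ha', h.ends_ne hclaw, h.ca.symm, h.adj_ends hclaw, h.cb,
    h.da.symm, (h.swap.adj_ends hclaw).symm, h.db, h.cq, hyy.symm, h.dq, hyb.symm, hmem, hcard⟩

theorem exists_isEdgeTheta (h : IsEar G K c d q q' a a' b b' Q A B) (hK : IsCore G K)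
    (hclaw : ClawFree G) (hc : c ∉ K) (hd : d ∉ K) :
    ∃ x y α α' β β' μ μ', IsEdgeTheta G K x y α α' β β' μ μ' := by
  by_cases ha : a ∈ K
  · exact h.exists_isEdgeTheta_of_mem hK hclaw hc hd ha
  by_cases ha' : a' ∈ K
  · exact h.swap.rev.exists_isEdgeTheta_of_mem hK hclaw hd hc ha'
  by_cases hb : b ∈ K
  · exact h.swap.exists_isEdgeTheta_of_mem hK hclaw hd hc hb
  by_cases hb' : b' ∈ K
  · exact h.rev.exists_isEdgeTheta_of_mem hK hclaw hc hd hb'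
  exfalso
  have haA := h.pathA.left_mem
  have ha'A := h.pathA.right_mem
  have hbB := h.pathB.left_mem
  have hb'B := h.pathB.right_mem
  have hAB := Finset.disjoint_left.1 h.disjoint_AB
  have hQA := Finset.disjoint_left.1 h.disjoint_QA
  have hQB := Finset.disjoint_left.1 h.disjoint_QB
  have hcn := h.c_notMem
  have hdn := h.d_notMem
  have hne := h.ne
  have hbb' : b ≠ b' := h.swap.ends_ne hclaw
  have haa' := h.ends_ne hclaw
  have hqQ := h.pathQ.left_mem
  have hq := h.notMem_of_mem_path hqQ
  have hmem := (hK.notMem_iff_of_nodup (l := [c, d, a, a', b, b'])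
    (by simp only [List.nodup_cons, List.mem_cons, List.not_mem_nil]; grind (splits := 20))
    (by simp [*]) rfl).1
  have := (hmem q).1 hq
  grind

end IsEar

theorem exists_isFrame (h2 : TwoConnected G) (hclaw : ClawFree G) {K : Finset V}
    (hK : IsCore G K) : Kᶜ.card = 6 ∧ ∃ a b m, IsFrame G K a b m := by
  obtain ⟨c, d, q, q', a, a', b, b', Q, A, B, h⟩ := exists_isEar h2 hK
  by_cases hc : c ∈ K
  · obtain ⟨a, b, m, h⟩ := h.exists_isTriangleTheta hK hclaw hc
    exact ⟨h.card_compl, a, b, m, h.isFrame hK⟩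
  by_cases hd : d ∈ K
  · obtain ⟨a, b, m, h⟩ := h.swap.exists_isTriangleTheta hK hclaw hd
    exact ⟨h.card_compl, a, b, m, h.isFrame hK⟩
  obtain ⟨x, y, α, α', β, β', μ, μ', h⟩ := h.exists_isEdgeTheta hK hclaw hc hd
  obtain ⟨z, hz, hzn⟩ := Finset.exists_mem_notMem_of_card_lt_card (s := {x, y}) (t := K)
    (Finset.card_le_two.trans_lt (hK.three_le_card h.left h.left_adj h.left'))
  simp only [Finset.mem_insert, Finset.mem_singleton, not_or] at hzn
  exact ⟨h.card_compl, _, _, _, h.isFrame hK hz hzn.1 hzn.2⟩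

end Core

theorem statement_8 {V : Type*} [Fintype V] [DecidableEq V] (G : SimpleGraph V) (n : ℕ)
    (hcard : Fintype.card V = n)
    (h2conn : TwoConnected G) (hclosed : IsClosedGraph G) (hclaw : ClawFree G)
    (hham : ¬ G.IsHamiltonian) (hclique : G.cliqueNum ≥ n - 6) :
    ∃ t ∈ ({(fun _ => true), ![false, true, true], ![false, false, true],
        (fun _ => false)} : Set (Fin 3 → Bool)),
      ∃ T : Finset (Fin 9), (Pgraph t).IsNClique 3 T ∧
        Nonempty (G ≃g expandGraph (Pgraph t) (↑T) (n - 9)) := by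
  obtain ⟨K, hK⟩ := exists_isCore h2conn hclosed hclaw hham (hcard ▸ hclique)
  obtain ⟨hc, a, b, m, h⟩ := exists_isFrame h2conn hclaw hK
  exact hcard ▸ h.exists_iso hK.isClique hc
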